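/- Let Ǎ ∈ ℝ^{ř×ř} have all eigenvalues in the closed unit disc, let K ∈ ℝ^{p×ř}, B̌ ∈ ℝ^{ř×p} be such that Ǎ − B̌K is Schur stable, and let H ∈ ℝ^{ř×p}, Č ∈ ℝ^{p×ř} be such that Ǎ − HČ is Schur stable. Let D̄ = (d̄_{ij}) ∈ ℝ^{N×N} be lower triangular with nonnegative entries and diagonal entries d̄_{ii} < 1, and let Δ ∈ ℂ^{N×N} be lower triangular with Δ_{ii} = d̄_{ii} for all i and, for i > j, Δ_{ij} = d̄_{ij} z_{ij} for some complex numbers z_{ij} of modulus 1. Let A_s = diag(A_{1,s},…,A_{N,s}) with each A_{i,s} ∈ ℝ^{s×s} Schur stable and C_s = diag(C_{1,s},…,C_{N,s}) with C_{i,s} ∈ ℝ^{p×s}. Then the complex block matrix [[I_N ⊗ (Ǎ − B̌K), I_N ⊗ (B̌K), 0, (I_N ⊗ B̌)C_s], [0, Δ ⊗ Ǎ, I_N ⊗ Ǎ, (I_N ⊗ B̌)C_s], [(D̄ − Δ) ⊗ (HČ), 0, I_N ⊗ (Ǎ − HČ), ((I_N − Δ) ⊗ B̌)C_s], [0, 0,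 0, A_s]] has no eigenvalue on the unit circle (no eigenvalue of modulus 1). -/

import Mathlib

open Matrix Kronecker

/-- Complexification of a real matrix (entrywise). -/
noncomputable def toC {ι κ : Type*} (M : Matrix ι κ ℝ) : Matrix ι κ ℂ :=
  M.map Complex.ofReal

/-- A square complex matrix is Schur stable if all its eigenvalues lie in the
open unit disc. -/
def SchurStable {ι : Type*} [Fintype ι] [DecidableEq ι] (M : Matrix ι ι ℂ) : Prop :=
  ∀ z ∈ spectrum ℂ M, ‖z‖ < 1

/-- Block-diagonal matrix diag(M 1, …, M N) with block index first. -/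
def bDiagC {N s t : ℕ} (M : Fin N → Matrix (Fin s) (Fin t) ℂ) :
    Matrix (Fin N × Fin s) (Fin N × Fin t) ℂ :=
  Matrix.of fun q q' => if q.1 = q'.1 then M q.1 q.2 q'.2 else 0

/-- Membership in the spectrum of a matrix amounts to the existence of an eigenvector. -/
theorem mem_spectrum_iff_exists_mulVec {ι : Type*} [Fintype ι] [DecidableEq ι]
    (M : Matrix ι ι ℂ) (z : ℂ) :
    z ∈ spectrum ℂ M ↔ ∃ v : ι → ℂ, v ≠ 0 ∧ M *ᵥ v = z • v := by
  rw [← Matrix.spectrum_toLin', ← Module.End.hasEigenvalue_iff_mem_spectrum]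
  constructor
  · intro h
    obtain ⟨v, hv⟩ := h.exists_hasEigenvector
    exact ⟨v, hv.2, by simpa using hv.apply_eq_smul⟩
  · rintro ⟨v, hv, h⟩
    exact Module.End.hasEigenvalue_of_hasEigenvector
      ⟨Module.End.mem_eigenspace_iff.2 (by simpa using h), hv⟩

theorem SchurStable.eq_zero_of_mulVec_eq {ι : Type*} [Fintype ι] [DecidableEq ι]
    {M : Matrix ι ι ℂ} (hM : SchurStable M) {z : ℂ} (hz : ‖z‖ = 1) {v : ι → ℂ}
    (hv : M *ᵥ v = z • v) : v = 0 := by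
  by_contra h
  exact (hM z ((mem_spectrum_iff_exists_mulVec M z).2 ⟨v, h, hv⟩)).ne hz

/-- Scaling a matrix with spectral radius at most one by a factor in the open unit disc makes it
Schur stable. -/
theorem schurStable_smul {ι : Type*} [Fintype ι] [DecidableEq ι]
    {M : Matrix ι ι ℂ} (hM : ∀ z ∈ spectrum ℂ M, ‖z‖ ≤ 1) {d : ℂ} (hd : ‖d‖ < 1) :
    SchurStable (d • M) := by
  intro z hz
  obtain ⟨v, hv, h⟩ := (mem_spectrum_iff_exists_mulVec _ z).1 hz
  rw [Matrix.smul_mulVec] at h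
  rcases eq_or_ne d 0 with rfl | hd0
  · have : z = 0 := by simpa [hv] using h.symm
    simp [this]
  · have hs : d⁻¹ * z ∈ spectrum ℂ M := by
      refine (mem_spectrum_iff_exists_mulVec M _).2 ⟨v, hv, ?_⟩
      rw [mul_smul, ← h, smul_smul, inv_mul_cancel₀ hd0, one_smul]
    calc ‖z‖ = ‖d‖ * ‖d⁻¹ * z‖ := by rw [← norm_mul, mul_inv_cancel_left₀ hd0]
      _ ≤ ‖d‖ * 1 := by gcongr; exact hM _ hs
      _ < 1 := by rwa [mul_one]

theorem kronecker_mulVec_apply {l m n o : Type*} [Fintype m] [Fintype o]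
    (A : Matrix l m ℂ) (B : Matrix n o ℂ) (v : m × o → ℂ) (i : l) (a : n) :
    (A ⊗ₖ B *ᵥ v) (i, a) = ∑ j, A i j * (B *ᵥ fun b => v (j, b)) a := by
  simp only [Matrix.mulVec, dotProduct, Fintype.sum_prod_type, kroneckerMap_apply,
    Finset.mul_sum, mul_assoc]

theorem kronecker_mulVec_apply_of_lower {N : ℕ} {n o : Type*} [Fintype o]
    (A : Matrix (Fin N) (Fin N) ℂ) (B : Matrix n o ℂ) (v : Fin N × o → ℂ) (i : Fin N) (a : n)
    (hA : ∀ j, i < j → A i j = 0) (hv : ∀ j < i, (fun b => v (j, b)) = 0) :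
    (A ⊗ₖ B *ᵥ v) (i, a) = A i i * (B *ᵥ fun b => v (i, b)) a := by
  rw [kronecker_mulVec_apply]
  refine Finset.sum_eq_single i (fun j _ hj => ?_) (by simp)
  rcases lt_or_gt_of_ne hj with h | h
  · rw [hv j h]; simp
  · simp [hA j h]

theorem one_kronecker_mulVec_apply {m n o : Type*} [Fintype m] [DecidableEq m] [Fintype o]
    (B : Matrix n o ℂ) (v : m × o → ℂ) (i : m) (a : n) :
    ((1 : Matrix m m ℂ) ⊗ₖ B *ᵥ v) (i, a) = (B *ᵥ fun b => v (i, b)) a := by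
  simp [kronecker_mulVec_apply, Matrix.one_apply]

theorem bDiagC_mulVec_apply {N s t : ℕ} (M : Fin N → Matrix (Fin s) (Fin t) ℂ)
    (v : Fin N × Fin t → ℂ) (i : Fin N) (a : Fin s) :
    (bDiagC M *ᵥ v) (i, a) = (M i *ᵥ fun b => v (i, b)) a := by
  simp [bDiagC, Matrix.mulVec, dotProduct, Fintype.sum_prod_type, ite_mul]

/-- Frequency-domain condition in the proof of Theorem 3: the delayed
closed-loop matrix of the heterogeneous network has no eigenvalue on the
unit circle. -/
theorem stmt9
    (rr p s N : ℕ)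
    (Ah : Matrix (Fin rr) (Fin rr) ℝ) (Bh : Matrix (Fin rr) (Fin p) ℝ)
    (Ch : Matrix (Fin p) (Fin rr) ℝ)
    (K : Matrix (Fin p) (Fin rr) ℝ) (H : Matrix (Fin rr) (Fin p) ℝ)
    (hAh : ∀ z ∈ spectrum ℂ (toC Ah), ‖z‖ ≤ 1)
    (hABK : SchurStable (toC (Ah - Bh * K)))
    (hAHC : SchurStable (toC (Ah - H * Ch)))
    (D : Matrix (Fin N) (Fin N) ℝ)
    (hDlt : ∀ i j : Fin N, i < j → D i j = 0)
    (hDnonneg : ∀ i j : Fin N, 0 ≤ D i j)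
    (hDdiag : ∀ i : Fin N, D i i < 1)
    (Δ : Matrix (Fin N) (Fin N) ℂ)
    (hΔlt : ∀ i j : Fin N, i < j → Δ i j = 0)
    (hΔdiag : ∀ i : Fin N, Δ i i = (D i i : ℂ))
    (hΔoff : ∀ i j : Fin N, j < i → ∃ z : ℂ, ‖z‖ = 1 ∧ Δ i j = (D i j : ℂ) * z)
    (As : Fin N → Matrix (Fin s) (Fin s) ℝ)
    (hAs : ∀ i : Fin N, SchurStable (toC (As i)))
    (Cs : Fin N → Matrix (Fin p) (Fin s) ℝ) :
    ∀ z ∈ spectrum ℂ (Matrix.fromBlocks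
      (Matrix.fromBlocks
        ((1 : Matrix (Fin N) (Fin N) ℂ) ⊗ₖ toC (Ah - Bh * K))
        ((1 : Matrix (Fin N) (Fin N) ℂ) ⊗ₖ toC (Bh * K))
        (0 : Matrix (Fin N × Fin rr) (Fin N × Fin rr) ℂ)
        (Δ ⊗ₖ toC Ah))
      (Matrix.fromBlocks
        (0 : Matrix (Fin N × Fin rr) (Fin N × Fin rr) ℂ)
        (((1 : Matrix (Fin N) (Fin N) ℂ) ⊗ₖ toC Bh) * bDiagC (fun i => toC (Cs i)))
        ((1 : Matrix (Fin N) (Fin N) ℂ) ⊗ₖ toC Ah)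
        (((1 : Matrix (Fin N) (Fin N) ℂ) ⊗ₖ toC Bh) * bDiagC (fun i => toC (Cs i))))
      (Matrix.fromBlocks
        ((toC D - Δ) ⊗ₖ toC (H * Ch))
        (0 : Matrix (Fin N × Fin rr) (Fin N × Fin rr) ℂ)
        (0 : Matrix (Fin N × Fin s) (Fin N × Fin rr) ℂ)
        (0 : Matrix (Fin N × Fin s) (Fin N × Fin rr) ℂ))
      (Matrix.fromBlocks
        ((1 : Matrix (Fin N) (Fin N) ℂ) ⊗ₖ toC (Ah - H * Ch))
        ((((1 : Matrix (Fin N) (Fin N) ℂ) - Δ) ⊗ₖ toC Bh) * bDiagC (fun i => toC (Cs i)))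
        (0 : Matrix (Fin N × Fin s) (Fin N × Fin rr) ℂ)
        (bDiagC (fun i => toC (As i))))), ‖z‖ ≠ 1 := by
  intro z hz hz1
  obtain ⟨v, hv, h⟩ := (mem_spectrum_iff_exists_mulVec _ z).1 hz
  obtain ⟨u, w, rfl⟩ : ∃ u w, v = Sum.elim u w := ⟨_, _, (Sum.elim_comp_inl_inr v).symm⟩
  obtain ⟨x, y, rfl⟩ : ∃ x y, u = Sum.elim x y := ⟨_, _, (Sum.elim_comp_inl_inr u).symm⟩
  obtain ⟨e, q, rfl⟩ : ∃ e q, w = Sum.elim e q := ⟨_, _, (Sum.elim_comp_inl_inr w).symm⟩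
  have hq : q = 0 := by
    have hqi : ∀ i, (fun b => q (i, b)) = 0 := fun i => by
      refine (hAs i).eq_zero_of_mulVec_eq hz1 (funext fun a => ?_)
      simpa [Matrix.fromBlocks_mulVec, bDiagC_mulVec_apply] using
        congrFun h (Sum.inr (Sum.inr (i, a)))
    exact funext fun ⟨i, b⟩ => congrFun (hqi i) b
  subst hq
  have key : ∀ i, (fun b => x (i, b)) = 0 ∧ (fun b => y (i, b)) = 0 ∧
      (fun b => e (i, b)) = 0 := by
    intro i
    induction i using WellFoundedLT.induction with
    | ind i ih =>
    have he : (fun b => e (i, b)) = 0 := by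
      refine hAHC.eq_zero_of_mulVec_eq hz1 (funext fun a => ?_)
      have h3 := congrFun h (Sum.inr (Sum.inl (i, a)))
      have hx := kronecker_mulVec_apply_of_lower (toC D - Δ) (toC (H * Ch)) x i a
        (fun j hj => by simp [toC, hDlt i j hj, hΔlt i j hj]) (fun j hj => (ih j hj).1)
      have hd : (toC D - Δ) i i = 0 := by simp [toC, hΔdiag]
      rw [hd, zero_mul] at hx
      simpa [Matrix.fromBlocks_mulVec, hx, one_kronecker_mulVec_apply] using h3
    have hy : (fun b => y (i, b)) = 0 := by
      have hd : ‖Δ i i‖ < 1 := by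
        rw [hΔdiag, Complex.norm_real, Real.norm_of_nonneg (hDnonneg i i)]
        exact hDdiag i
      refine (schurStable_smul hAh hd).eq_zero_of_mulVec_eq hz1 (funext fun a => ?_)
      have h2 := congrFun h (Sum.inl (Sum.inr (i, a)))
      have hy' := kronecker_mulVec_apply_of_lower Δ (toC Ah) y i a (hΔlt i)
        (fun j hj => (ih j hj).2.1)
      simpa [Matrix.fromBlocks_mulVec, hy', one_kronecker_mulVec_apply, he,
        Matrix.smul_mulVec] using h2
    refine ⟨hABK.eq_zero_of_mulVec_eq hz1 (funext fun a => ?_), hy, he⟩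
    simpa [Matrix.fromBlocks_mulVec, one_kronecker_mulVec_apply, hy] using
      congrFun h (Sum.inl (Sum.inl (i, a)))
  refine hv (funext ?_)
  rintro ((⟨i, b⟩ | ⟨i, b⟩) | (⟨i, b⟩ | ⟨i, b⟩))
  · exact congrFun (key i).1 b
  · exact congrFun (key i).2.1 b
  · exact congrFun (key i).2.2 b
  · rfl
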